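/- arXiv:1909.01262 — 5 statements merged into one kernel-verified Lean document; each statement's English description precedes it below -/
import Mathlib

section
/- For all integers a ≤ −3 and τ ≥ 0, the following identity holds in SL(2,ℤ): T^(a+1) · S · (T^(−2) · S)^τ · T^(−1) = [[−τ−(τ+1)(1+a), a+2], [−(τ+1), 1]]. -/
/-- The generator `S = [[0,1],[-1,0]]` of `SL(2,ℤ)`. -/
def S : Matrix.SpecialLinearGroup (Fin 2) ℤ :=
  ⟨!![0, 1; -1, 0], by norm_num [Matrix.det_fin_two_of]⟩

/-- The generator `T = [[1,1],[0,1]]` of `SL(2,ℤ)`. -/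
def T : Matrix.SpecialLinearGroup (Fin 2) ℤ :=
  ⟨!![1, 1; 0, 1], by norm_num [Matrix.det_fin_two_of]⟩

theorem T_eq_modularGroup_T : T = ModularGroup.T := rfl

theorem coe_T_zpow (n : ℤ) :
    ((T ^ n : Matrix.SpecialLinearGroup (Fin 2) ℤ) : Matrix (Fin 2) (Fin 2) ℤ) =
      !![1, n; 0, 1] := by
  rw [T_eq_modularGroup_T, ModularGroup.coe_T_zpow]

theorem coe_S : (S : Matrix (Fin 2) (Fin 2) ℤ) = !![0, 1; -1, 0] := rfl

theorem coe_T_zpow_neg_two_mul_S_pow (n : ℕ) :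
    (((T ^ (-2 : ℤ) * S) ^ n : Matrix.SpecialLinearGroup (Fin 2) ℤ) :
        Matrix (Fin 2) (Fin 2) ℤ) =
      !![(n : ℤ) + 1, n; -n, 1 - n] := by
  induction n with
  | zero => simp [Matrix.one_fin_two]
  | succ n ih =>
    rw [pow_succ, Matrix.SpecialLinearGroup.coe_mul, ih, Matrix.SpecialLinearGroup.coe_mul,
      coe_T_zpow, coe_S]
    ext i j
    fin_cases i <;> fin_cases j <;> simp [Matrix.mul_apply, Fin.sum_univ_two] <;> ring

/-- For all integers `a ≤ -3` and `τ ≥ 0`, in `SL(2,ℤ)` we have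
`T^(a+1) * S * (T^(-2) * S)^τ * T^(-1) = [[-τ-(τ+1)(1+a), a+2], [-(τ+1), 1]]`. -/
theorem stmt_0 (a τ : ℤ) (ha : a ≤ -3) (hτ : 0 ≤ τ) :
    ((T ^ (a + 1) * S * (T ^ (-2 : ℤ) * S) ^ τ * T ^ (-1 : ℤ) :
        Matrix.SpecialLinearGroup (Fin 2) ℤ) : Matrix (Fin 2) (Fin 2) ℤ) =
      !![-τ - (τ + 1) * (1 + a), a + 2; -(τ + 1), 1] := by
  lift τ to ℕ using hτ
  simp only [zpow_natCast, Matrix.SpecialLinearGroup.coe_mul]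
  rw [coe_T_zpow_neg_two_mul_S_pow, coe_T_zpow, coe_T_zpow, coe_S]
  ext i j
  fin_cases i <;> fin_cases j <;> simp [Matrix.mul_apply, Fin.sum_univ_two] <;> ring
end

section
/- For all integers a ≤ −3 and τ ≥ 0, the vector (1, Λ^u) ∈ ℝ² is an eigenvector of the real matrix C_{a,τ}: there exists a real number λ with 0 < λ < 1 such that C_{a,τ} · (1, Λ^u)ᵀ = λ · (1, Λ^u)ᵀ. -/
/-- For integers `a ≤ -3`, `τ ≥ 0`, the matrix
`C_{a,τ} = [[-τ-(τ+1)(1+a), a+2], [-(τ+1), 1]]`, viewed as a real matrix. -/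
noncomputable def Cre (a τ : ℤ) : Matrix (Fin 2) (Fin 2) ℝ :=
  !![-(τ : ℝ) - ((τ : ℝ) + 1) * (1 + (a : ℝ)), (a : ℝ) + 2; -((τ : ℝ) + 1), 1]

/-- The discriminant-type quantity `D_{a,τ} = (1+τ)² + 4(1+τ)/|a+2|`. -/
noncomputable def Dd (a τ : ℤ) : ℝ :=
  (1 + (τ : ℝ)) ^ 2 + 4 * (1 + (τ : ℝ)) / |(a : ℝ) + 2|

/-- The unstable slope `Λᵘ = (1 + τ + √D_{a,τ})/2` of `C_{a,τ}`. -/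
noncomputable def Lu (a τ : ℤ) : ℝ := (1 + (τ : ℝ) + Real.sqrt (Dd a τ)) / 2

/-- The stable slope `Λˢ = (1 + τ - √D_{a,τ})/2` of `C_{a,τ}`. -/
noncomputable def Ls (a τ : ℤ) : ℝ := (1 + (τ : ℝ) - Real.sqrt (Dd a τ)) / 2

/-- `Λᵘ` is a root of the quadratic equation `|a + 2| x (x - (1 + τ)) = 1 + τ`. -/
theorem Lu_quadratic (a τ : ℤ) (ha : a ≤ -3) (hτ : 0 ≤ τ) :
    (-((a : ℝ) + 2)) * Lu a τ * (Lu a τ - (1 + τ)) = 1 + τ := by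
  have ha' : (a : ℝ) ≤ -3 := by exact_mod_cast ha
  have hτ' : (0 : ℝ) ≤ τ := by exact_mod_cast hτ
  have hn : 0 < -((a : ℝ) + 2) := by linarith
  have hD : 0 ≤ Dd a τ := by unfold Dd; positivity
  have hsq := Real.sq_sqrt hD
  have hmul : -((a : ℝ) + 2) * Dd a τ = -((a : ℝ) + 2) * (1 + τ) ^ 2 + 4 * (1 + τ) := by
    rw [Dd, abs_of_neg (by linarith)]
    rw [mul_add, mul_div_cancel₀ _ hn.ne']
  unfold Lu
  linear_combination (-((a : ℝ) + 2) / 4) * hsq + hmul / 4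

/-- The unstable slope exceeds `1 + τ`. -/
theorem lt_Lu (a τ : ℤ) (ha : a ≤ -3) (hτ : 0 ≤ τ) : 1 + (τ : ℝ) < Lu a τ := by
  have ha' : (a : ℝ) ≤ -3 := by exact_mod_cast ha
  have hτ' : (0 : ℝ) ≤ τ := by exact_mod_cast hτ
  have habs : 0 < |(a : ℝ) + 2| := abs_pos.mpr (by linarith)
  have h : 1 + (τ : ℝ) < √(Dd a τ) := by
    apply Real.lt_sqrt_of_sq_lt
    have : 0 < 4 * (1 + (τ : ℝ)) / |(a : ℝ) + 2| := by positivity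
    unfold Dd
    linarith
  unfold Lu
  linarith

/-- For all integers `a ≤ -3` and `τ ≥ 0`, the vector `(1, Λᵘ)` is an eigenvector of
`C_{a,τ}` with eigenvalue `λ` satisfying `0 < λ < 1`. -/
theorem stmt_3 (a τ : ℤ) (ha : a ≤ -3) (hτ : 0 ≤ τ) :
    ∃ lam : ℝ, 0 < lam ∧ lam < 1 ∧
      (Cre a τ).mulVec ![1, Lu a τ] = lam • ![1, Lu a τ] := by
  have hτ' : (0 : ℝ) ≤ τ := by exact_mod_cast hτ
  have hq := Lu_quadratic a τ ha hτ
  have hlt := lt_Lu a τ ha hτ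
  have hL : 0 < Lu a τ := by linarith
  have hdiv : (1 + (τ : ℝ)) / Lu a τ = -((a : ℝ) + 2) * (Lu a τ - (1 + τ)) := by
    rw [div_eq_iff hL.ne']
    linear_combination -hq
  refine ⟨1 - (1 + τ) / Lu a τ, ?_, ?_, ?_⟩
  · rw [sub_pos, div_lt_one hL]
    exact hlt
  · have : 0 < (1 + (τ : ℝ)) / Lu a τ := by positivity
    linarith
  · rw [hdiv]
    ext i
    fin_cases i
    · simp [Cre, Matrix.mulVec, dotProduct, Fin.sum_univ_two]
      ring
    · simp [Cre, Matrix.mulVec, dotProduct, Fin.sum_univ_two]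
      linear_combination hq
end

section
/- For all integers a ≤ −3 and τ ≥ 0, the vector (1, Λ^s) ∈ ℝ² is an eigenvector of the real matrix C_{a,τ} with an eigenvalue λ > 1, and the stable slope satisfies 1/(a+2) < Λ^s < 0. -/
/-- The stable slope is a root of `X² - (1 + τ) X - (1 + τ)/|a + 2|`. -/
lemma abs_mul_Ls_sq (a τ : ℤ) (ha : (a : ℝ) + 2 < 0) (hτ : 0 ≤ (τ : ℝ)) :
    |(a : ℝ) + 2| * Ls a τ ^ 2 =
      |(a : ℝ) + 2| * (1 + (τ : ℝ)) * Ls a τ + (1 + (τ : ℝ)) := by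
  have hn : 0 < |(a : ℝ) + 2| := abs_pos.mpr ha.ne
  have hD : 0 ≤ Dd a τ := by unfold Dd; positivity
  have hsq := Real.sq_sqrt hD
  have hnD : |(a : ℝ) + 2| * Dd a τ =
      |(a : ℝ) + 2| * (1 + (τ : ℝ)) ^ 2 + 4 * (1 + (τ : ℝ)) := by
    unfold Dd; field_simp
  unfold Ls
  linear_combination (|(a : ℝ) + 2| / 4) * hsq + hnD / 4

lemma Ls_neg (a τ : ℤ) (ha : (a : ℝ) + 2 < 0) (hτ : 0 ≤ (τ : ℝ)) : Ls a τ < 0 := by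
  have hn : 0 < |(a : ℝ) + 2| := abs_pos.mpr ha.ne
  have h : 1 + (τ : ℝ) < √(Dd a τ) := by
    apply Real.lt_sqrt_of_sq_lt
    unfold Dd
    have : 0 < 4 * (1 + (τ : ℝ)) / |(a : ℝ) + 2| := by positivity
    linarith
  unfold Ls
  linarith

lemma one_div_lt_Ls (a τ : ℤ) (ha : (a : ℝ) + 2 < 0) (hτ : 0 ≤ (τ : ℝ)) :
    1 / ((a : ℝ) + 2) < Ls a τ := by
  have hn : 0 < |(a : ℝ) + 2| := abs_pos.mpr ha.ne
  have h : √(Dd a τ) < 1 + (τ : ℝ) + 2 / |(a : ℝ) + 2| := by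
    rw [Real.sqrt_lt' (by positivity)]
    have h4 : 0 < 4 / |(a : ℝ) + 2| ^ 2 := by positivity
    have e : (1 + (τ : ℝ) + 2 / |(a : ℝ) + 2|) ^ 2 = Dd a τ + 4 / |(a : ℝ) + 2| ^ 2 := by
      unfold Dd; ring
    linarith
  have e : 1 / ((a : ℝ) + 2) = -(2 / |(a : ℝ) + 2|) / 2 := by
    rw [abs_of_neg ha, div_neg]; ring
  unfold Ls
  linarith

/-- For all integers `a ≤ -3` and `τ ≥ 0`, the vector `(1, Λˢ)` is an eigenvector of
`C_{a,τ}` with an eigenvalue `λ > 1`, and the stable slope satisfies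
`1/(a+2) < Λˢ < 0`. -/
theorem stmt_5 (a τ : ℤ) (ha : a ≤ -3) (hτ : 0 ≤ τ) :
    (∃ lam : ℝ, 1 < lam ∧ (Cre a τ).mulVec ![1, Ls a τ] = lam • ![1, Ls a τ]) ∧
    1 / ((a : ℝ) + 2) < Ls a τ ∧ Ls a τ < 0 := by
  have ha' : (a : ℝ) + 2 < 0 := by
    have : (a : ℝ) ≤ -3 := by exact_mod_cast ha
    linarith
  have hτ' : 0 ≤ (τ : ℝ) := by exact_mod_cast hτ
  have hneg := Ls_neg a τ ha' hτ'
  have hroot := abs_mul_Ls_sq a τ ha' hτ'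
  rw [abs_of_neg ha'] at hroot
  refine ⟨⟨1 + (-((a : ℝ) + 2)) * (1 + (τ : ℝ) - Ls a τ), ?_, ?_⟩,
    one_div_lt_Ls a τ ha' hτ', hneg⟩
  · have := mul_pos (neg_pos.mpr ha') (by linarith : 0 < 1 + (τ : ℝ) - Ls a τ)
    linarith
  · ext i
    fin_cases i
    · simp [Cre, Matrix.mulVec, dotProduct, Fin.sum_univ_two]
      ring
    · simp [Cre, Matrix.mulVec, dotProduct, Fin.sum_univ_two]
      linear_combination hroot
end

section
/- For all integers a ≤ −3 and τ ≥ 0, the set of integers n with Λ^s < n < Λ^u is exactly {0, 1, …, τ+1}; in particular, the open interval (Λ^s, Λ^u) contains precisely τ + 2 integers. -/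
theorem lt_sqrt_Dd {a τ : ℤ} (ha : a ≤ -3) (hτ : 0 ≤ τ) :
    1 + (τ : ℝ) < Real.sqrt (Dd a τ) := by
  have ht : (0 : ℝ) ≤ τ := by exact_mod_cast hτ
  have ha' : (a : ℝ) ≤ -3 := by exact_mod_cast ha
  have hm : 0 < |(a : ℝ) + 2| := abs_pos.mpr (by linarith)
  have hq : 0 < 4 * (1 + (τ : ℝ)) / |(a : ℝ) + 2| := by positivity
  refine Real.lt_sqrt_of_sq_lt ?_
  unfold Dd
  linarith

theorem sqrt_Dd_lt {a τ : ℤ} (ha : a ≤ -3) (hτ : 0 ≤ τ) :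
    Real.sqrt (Dd a τ) < 3 + (τ : ℝ) := by
  have ht : (0 : ℝ) ≤ τ := by exact_mod_cast hτ
  have ha' : (a : ℝ) ≤ -3 := by exact_mod_cast ha
  have hm : 1 ≤ |(a : ℝ) + 2| := le_abs.mpr (Or.inr (by linarith))
  have hq : 4 * (1 + (τ : ℝ)) / |(a : ℝ) + 2| ≤ 4 * (1 + (τ : ℝ)) :=
    div_le_self (by positivity) hm
  rw [Real.sqrt_lt' (by positivity)]
  unfold Dd
  nlinarith

/-- For all integers `a ≤ -3` and `τ ≥ 0`, the integers `n` with `Λˢ < n < Λᵘ` are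
exactly `{0, 1, …, τ+1}`; in particular the open interval `(Λˢ, Λᵘ)` contains
precisely `τ + 2` integers. -/
theorem stmt_7 (a τ : ℤ) (ha : a ≤ -3) (hτ : 0 ≤ τ) :
    {n : ℤ | Ls a τ < (n : ℝ) ∧ (n : ℝ) < Lu a τ} = Set.Icc 0 (τ + 1) ∧
    {n : ℤ | Ls a τ < (n : ℝ) ∧ (n : ℝ) < Lu a τ}.ncard = (τ + 2).toNat := by
  have hlo := lt_sqrt_Dd ha hτ
  have hhi := sqrt_Dd_lt ha hτ
  have key : {n : ℤ | Ls a τ < (n : ℝ) ∧ (n : ℝ) < Lu a τ} = Set.Icc 0 (τ + 1) := by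
    ext n
    simp only [Set.mem_ofPred_eq, Set.mem_Icc, Ls, Lu]
    constructor
    · rintro ⟨h₁, h₂⟩
      have h₃ : (-1 : ℝ) < n := by linarith
      have h₄ : (n : ℝ) < τ + 2 := by linarith
      have h₅ : -1 < n := by exact_mod_cast h₃
      have h₆ : n < τ + 2 := by exact_mod_cast h₄
      omega
    · rintro ⟨h₁, h₂⟩
      have h₃ : (0 : ℝ) ≤ n := by exact_mod_cast h₁
      have h₄ : (n : ℝ) ≤ τ + 1 := by exact_mod_cast h₂
      constructor <;> linarith
  refine ⟨key, ?_⟩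
  rw [key, ← Finset.coe_Icc, Set.ncard_coe_finset, Int.card_Icc]
  congr 1
  ring
end

section
/- Let a ≤ −3 and τ ≥ 0 be integers, and let k be an integer with 1 ≤ k ≤ −(a+3). If a rational number x is a Farey neighbor of −1/k and satisfies Λ^s ≤ x ≤ Λ^u, then x = 0. In other words, 0 is the only rational number in the interval [Λ^s, Λ^u] connected on the Farey tessellation to any of the slopes −1, −1/2, …, 1/(a+3). -/
/-- Two rationals (automatically in lowest terms with positive denominator in Lean)
are Farey neighbors if `|p·s − r·q| = 1`, where `x = p/q` and `y = r/s`. -/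
def FareyNbr (x y : ℚ) : Prop :=
  |x.num * (y.den : ℤ) - y.num * (x.den : ℤ)| = 1

/-- A rational in lowest terms that is a Farey neighbor of `-1/k` satisfies `|p k + q| = 1`. -/
theorem FareyNbr.abs_num_mul_add_den {x : ℚ} {k : ℤ} (hk : 0 < k)
    (h : FareyNbr x (-1 / (k : ℚ))) : |x.num * k + x.den| = 1 := by
  have hcop : Nat.Coprime (-1 : ℤ).natAbs k.natAbs := by simp
  have hnum : (-1 / (k : ℚ)).num = -1 := by
    simpa using Rat.num_div_eq_of_coprime hk hcop
  have hden : ((-1 / (k : ℚ)).den : ℤ) = k := by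
    simpa using Rat.den_div_eq_of_coprime hk hcop
  rw [FareyNbr, hnum, hden] at h
  simpa using h

/-- The stable slope is larger than `1 / (a + 2)`. -/
theorem inv_lt_Ls {a τ : ℤ} (ha : a ≤ -3) (hτ : 0 ≤ τ) : 1 / ((a : ℝ) + 2) < Ls a τ := by
  have ha' : (a : ℝ) ≤ -3 := by exact_mod_cast ha
  have hτ' : (0 : ℝ) ≤ τ := by exact_mod_cast hτ
  have hm : 0 < -((a : ℝ) + 2) := by linarith
  have hi : 0 < 1 / -((a : ℝ) + 2) := by positivity
  have hneg : 1 / ((a : ℝ) + 2) = -(1 / -((a : ℝ) + 2)) := by rw [div_neg, neg_neg]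
  have hD : Dd a τ = (1 + (τ : ℝ)) ^ 2 + 4 * (1 + (τ : ℝ)) * (1 / -((a : ℝ) + 2)) := by
    rw [Dd, abs_of_neg (by linarith), mul_one_div]
  have hsqrt : Real.sqrt (Dd a τ) < 1 + τ + 2 * (1 / -((a : ℝ) + 2)) := by
    rw [Real.sqrt_lt' (by positivity), hD]
    nlinarith [mul_pos hi hi]
  rw [hneg, Ls]
  linarith

/-- Let `a ≤ -3`, `τ ≥ 0`, and `1 ≤ k ≤ -(a+3)`.  If a rational `x` is a Farey
neighbor of `-1/k` and `Λˢ ≤ x ≤ Λᵘ`, then `x = 0`: i.e. `0` is the only rational in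
`[Λˢ, Λᵘ]` connected on the Farey tessellation to any of `-1, -1/2, …, 1/(a+3)`. -/
theorem stmt_10 (a τ : ℤ) (ha : a ≤ -3) (hτ : 0 ≤ τ)
    (k : ℤ) (hk1 : 1 ≤ k) (hk2 : k ≤ -(a + 3))
    (x : ℚ) (hF : FareyNbr x (-1 / (k : ℚ)))
    (hxl : Ls a τ ≤ (x : ℝ)) (hxu : (x : ℝ) ≤ Lu a τ) : x = 0 := by
  have hk := hF.abs_num_mul_add_den (by omega)
  have hq : (0 : ℤ) < x.den := by exact_mod_cast x.den_pos
  rw [← Rat.num_eq_zero]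
  by_contra hp
  rcases lt_or_gt_of_ne hp with hneg | hpos
  · have hden : (x.den : ℤ) ≤ x.num * (a + 2) := by
      have := (abs_le.mp hk.le).2
      nlinarith
    have hden' : (x.den : ℝ) ≤ x.num * ((a : ℝ) + 2) := by exact_mod_cast hden
    have hq' : (0 : ℝ) < x.den := by exact_mod_cast hq
    have ha' : (a : ℝ) + 2 < 0 := by
      have : (a : ℝ) ≤ -3 := by exact_mod_cast ha
      linarith
    have hx : (x : ℝ) ≤ 1 / ((a : ℝ) + 2) := by
      rw [le_div_iff_of_neg ha', Rat.cast_def, div_mul_eq_mul_div, le_div_iff₀ hq']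
      linarith
    linarith [inv_lt_Ls ha hτ]
  · have := (abs_le.mp hk.le).2
    nlinarith
end
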